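/- arXiv:0905.0615 — 2 statements merged into one kernel-verified Lean document; each statement's English description precedes it below -/
import Mathlib

section
/- There exists a real constant α[0] such that: (i) the equation u = T⁻u + α[0] admits a continuous real-valued solution u on X, and likewise the equation u = T⁺u − α[0] admits a continuous real-valued solution; and (ii) for every α < α[0] there exists no α-dominated function u : X → ℝ. -/
open Metric Set Filter Topology

/-- `X` is a `B`-length space at scale `K`. -/
def IsBLengthSpaceAtScale (X : Type*) [MetricSpace X] (B K : ℝ) : Prop :=
  ∀ x y : X, ∃ (n : ℕ) (p : ℕ → X), p 0 = x ∧ p n = y ∧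
    (∀ i < n, dist (p i) (p (i + 1)) ≤ K) ∧
    ∑ i ∈ Finset.range n, dist (p i) (p (i + 1)) ≤ B * dist x y

/-- Uniform superlinearity of the cost `c`. -/
def UniformlySuperlinear {X : Type*} [MetricSpace X] (c : X → X → ℝ) : Prop :=
  ∀ k : ℝ, 0 ≤ k → ∃ C : ℝ, ∀ x y : X, k * dist x y - C ≤ c x y

/-- Uniform boundedness of the cost `c`. -/
def UniformlyBounded {X : Type*} [MetricSpace X] (c : X → X → ℝ) : Prop :=
  ∀ R : ℝ, ∃ A : ℝ, ∀ x y : X, dist x y ≤ R → c x y ≤ A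

/-- `u` is `α`-dominated: `u y - u x ≤ c x y + α` for all `x y`. -/
def Dominated {X : Type*} (c : X → X → ℝ) (α : ℝ) (u : X → ℝ) : Prop :=
  ∀ x y : X, u y - u x ≤ c x y + α

/-- Negative Lax-Oleinik semigroup. -/
noncomputable def Tm {X : Type*} (c : X → X → ℝ) (u : X → ℝ) (x : X) : ℝ :=
  ⨅ y, (u y + c y x)

/-- Positive Lax-Oleinik semigroup. -/
noncomputable def Tp {X : Type*} (c : X → X → ℝ) (u : X → ℝ) (x : X) : ℝ :=
  ⨆ y, (u y - c x y)

/-- The critical constant `α[0]`: the smallest `α` for which `α`-dominated functions exist. -/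
noncomputable def critValue {X : Type*} (c : X → X → ℝ) : ℝ :=
  sInf {α : ℝ | ∃ u : X → ℝ, Dominated c α u}

/-- The Mañé potential `φ(x,y) = sup_u (u y - u x)`, sup over critical sub-solutions. -/
noncomputable def mane {X : Type*} (c : X → X → ℝ) (x y : X) : ℝ :=
  sSup {r : ℝ | ∃ u : X → ℝ, Dominated c (critValue c) u ∧ r = u y - u x}

/-- A bi-infinite sequence is `(u,c,α)`-calibrated if all its finite subchains of
consecutive terms are calibrated. -/
def IsCalibrated {X : Type*} (c : X → X → ℝ) (α : ℝ) (u : X → ℝ) (x : ℤ → X) : Prop :=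
  ∀ (m : ℤ) (k : ℕ), u (x (m + k)) =
    u (x m) + (∑ i ∈ Finset.range k, c (x (m + i)) (x (m + i + 1))) + k * α

/-- The projected Aubry set of a critical sub-solution `u`. -/
def projAubry {X : Type*} (c : X → X → ℝ) (u : X → ℝ) : Set X :=
  {p : X | ∃ x : ℤ → X, IsCalibrated c (critValue c) u x ∧ x 0 = p}

/-- The set `Â_u` of pairs of consecutive terms of calibrated bi-infinite sequences. -/
def aubryPairs {X : Type*} (c : X → X → ℝ) (u : X → ℝ) : Set (X × X) :=
  {q : X × X | ∃ (x : ℤ → X) (n : ℤ),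
    IsCalibrated c (critValue c) u x ∧ x n = q.1 ∧ x (n + 1) = q.2}

/-- The projected Aubry set `A = ∩_u A_u`, intersection over all critical sub-solutions. -/
def projAubrySet {X : Type*} (c : X → X → ℝ) : Set X :=
  {p : X | ∀ u : X → ℝ, Dominated c (critValue c) u → p ∈ projAubry c u}

/-- The Aubry pair set `Â = ∩_u Â_u`, intersection over all critical sub-solutions. -/
def aubryPairsSet {X : Type*} (c : X → X → ℝ) : Set (X × X) :=
  {q : X × X | ∀ u : X → ℝ, Dominated c (critValue c) u → q ∈ aubryPairs c u}

/-- `c_n(x,y)`: infimum of total cost over chains of length `n` from `x` to `y`. -/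
noncomputable def cChain {X : Type*} (c : X → X → ℝ) (n : ℕ) (x y : X) : ℝ :=
  sInf {r : ℝ | ∃ p : ℕ → X, p 0 = x ∧ p n = y ∧
    r = ∑ i ∈ Finset.range n, c (p i) (p (i + 1))}

/-- `φ_n(x,y) = inf_{k ≥ n} (c_k(x,y) + k·α)`. -/
noncomputable def phiN {X : Type*} (c : X → X → ℝ) (α : ℝ) (n : ℕ) (x y : X) : ℝ :=
  sInf {r : ℝ | ∃ k : ℕ, n ≤ k ∧ r = cChain c k x y + k * α}

/-- The Peierls barrier, with values in the extended reals. -/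
noncomputable def peierls {X : Type*} (c : X → X → ℝ) (α : ℝ) (x y : X) : EReal :=
  Filter.liminf (fun n : ℕ => ((cChain c n x y + n * α : ℝ) : EReal)) Filter.atTop

/-- Negative Lax-Oleinik semigroup on extended-real-valued functions. -/
noncomputable def eTm {X : Type*} (c : X → X → ℝ) (u : X → EReal) (x : X) : EReal :=
  ⨅ y, (u y + (c y x : EReal))

/-- Positive Lax-Oleinik semigroup on extended-real-valued functions. -/
noncomputable def eTp {X : Type*} (c : X → X → ℝ) (u : X → EReal) (x : X) : EReal :=
  ⨆ y, (u y - (c x y : EReal))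

section Domination

variable {X : Type*} {c : X → X → ℝ} {α : ℝ} {u : X → ℝ}

lemma Dominated.sub_const (hu : Dominated c α u) (a : ℝ) : Dominated c α (fun x => u x - a) := by
  intro x y
  have := hu x y
  simp only
  linarith

/-- The infimum over `z` of `u z + c z x + α` is at most `w x`. -/
def IsSupersolutionAt (c : X → X → ℝ) (α : ℝ) (u w : X → ℝ) (x : X) : Prop :=
  ∀ ε > 0, ∃ z, u z + c z x + α ≤ w x + ε

lemma IsSupersolutionAt.sub_const {w : X → ℝ} {x : X} (h : IsSupersolutionAt c α u w x) (a : ℝ) :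
    IsSupersolutionAt c α (fun x => u x - a) (fun x => w x - a) x := by
  intro ε hε
  obtain ⟨z, hz⟩ := h ε hε
  exact ⟨z, by simp only; linarith⟩

lemma isSupersolutionAt_Tm [Nonempty X] (c : X → X → ℝ) (α : ℝ) (u : X → ℝ) (x : X) :
    IsSupersolutionAt c α u (fun x => Tm c u x + α) x := by
  intro ε hε
  obtain ⟨z, hz⟩ := exists_lt_of_ciInf_lt
    (show (⨅ y, (u y + c y x)) < Tm c u x + ε by unfold Tm; linarith)
  exact ⟨z, by simp only; linarith⟩

/-- A pointwise bounded sequence of functions converges pointwise along any ultrafilter. -/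
lemma exists_tendsto_of_pointwise_bounded {ι : Type*} (F : Ultrafilter ι) (v : ι → X → ℝ)
    (hv : ∀ x, ∃ a b, ∀ i, v i x ∈ Icc a b) :
    ∃ w : X → ℝ, ∀ x, Tendsto (fun i => v i x) F (𝓝 (w x)) := by
  have key : ∀ x, ∃ l, Tendsto (fun i => v i x) F (𝓝 l) := by
    intro x
    obtain ⟨a, b, h⟩ := hv x
    obtain ⟨l, -, hl⟩ := (isCompact_Icc (a := a) (b := b)).ultrafilter_le_nhds
      (F.map fun i => v i x) (by
        rw [le_principal_iff]
        exact Filter.mem_map.2 (Filter.Eventually.of_forall h))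
    exact ⟨l, hl⟩
  choose w hw using key
  exact ⟨w, hw⟩

lemma Dominated.mem_Icc (hu : Dominated c α u) {o : X} (ho : u o = 0) (x : X) :
    u x ∈ Icc (-(c x o + α)) (c o x + α) := by
  have h₁ := hu o x
  have h₂ := hu x o
  constructor <;> linarith

lemma bddBelow_dominated [Nonempty X] (c : X → X → ℝ) :
    BddBelow {α : ℝ | ∃ u : X → ℝ, Dominated c α u} := by
  obtain ⟨o⟩ := ‹Nonempty X›
  refine ⟨-c o o, ?_⟩
  rintro α ⟨u, hu⟩
  have := hu o o
  linarith

/-- The infimum defining the critical value is attained. -/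
lemma exists_dominated_critValue [Nonempty X]
    (hne : {α : ℝ | ∃ u : X → ℝ, Dominated c α u}.Nonempty) :
    ∃ u : X → ℝ, Dominated c (critValue c) u := by
  obtain ⟨o⟩ := ‹Nonempty X›
  have hex : ∀ n : ℕ, ∃ u : X → ℝ, u o = 0 ∧ Dominated c (critValue c + 1 / ((n : ℝ) + 1)) u := by
    intro n
    have hpos : (0 : ℝ) < 1 / ((n : ℝ) + 1) := by positivity
    obtain ⟨a, ⟨u, hu⟩, ha⟩ := exists_lt_of_csInf_lt hne
      (show sInf {α : ℝ | ∃ u : X → ℝ, Dominated c α u} < critValue c + 1 / ((n : ℝ) + 1) by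
        unfold critValue; linarith)
    refine ⟨fun x => u x - u o, by simp, fun x y => ?_⟩
    have := hu x y
    simp only
    linarith
  choose v hv0 hv using hex
  obtain ⟨w, hw⟩ := exists_tendsto_of_pointwise_bounded (hyperfilter ℕ) v fun x => by
    refine ⟨-(c x o + (critValue c + 1)), c o x + (critValue c + 1), fun n => ?_⟩
    have h1 : 1 / ((n : ℝ) + 1) ≤ 1 := by
      rw [div_le_one (by positivity)]
      linarith [(Nat.cast_nonneg n : (0 : ℝ) ≤ n)]
    have := (hv n).mem_Icc (hv0 n) x
    exact ⟨by linarith [this.1], by linarith [this.2]⟩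
  refine ⟨w, fun x y => ?_⟩
  have hlim : Tendsto (fun n : ℕ => c x y + (critValue c + 1 / ((n : ℝ) + 1)))
      (hyperfilter ℕ) (𝓝 (c x y + (critValue c + 0))) :=
    ((tendsto_one_div_add_atTop_nhds_zero_nat.mono_left Nat.hyperfilter_le_atTop).const_add
      _).const_add _
  simpa using le_of_tendsto_of_tendsto' ((hw y).sub (hw x)) hlim fun n => hv n x y

/-- The largest dominated function vanishing at `x` is a supersolution away from `x`. -/
lemma exists_dominated_isSupersolutionAt_of_ne (hu : Dominated c α u) (x : X) :
    ∃ φ : X → ℝ, Dominated c α φ ∧ ∀ y, y ≠ x → IsSupersolutionAt c α φ φ y := by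
  classical
  let S : X → Set ℝ := fun y => {r | ∃ v : X → ℝ, Dominated c α v ∧ v x = 0 ∧ r = v y}
  have hbdd : ∀ y, BddAbove (S y) := by
    refine fun y => ⟨c x y + α, ?_⟩
    rintro r ⟨v, hv, hv0, rfl⟩
    exact (hv.mem_Icc hv0 y).2
  have hne : ∀ y, (S y).Nonempty := fun y =>
    ⟨_, fun z => u z - u x, hu.sub_const _, by simp, rfl⟩
  set φ : X → ℝ := fun y => sSup (S y) with hφ
  have hle : ∀ v : X → ℝ, Dominated c α v → v x = 0 → ∀ y, v y ≤ φ y := fun v hv hv0 y =>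
    le_csSup (hbdd y) ⟨v, hv, hv0, rfl⟩
  have hdom : Dominated c α φ := by
    intro y z
    have : φ z ≤ φ y + c y z + α := by
      refine csSup_le (hne z) ?_
      rintro r ⟨v, hv, hv0, rfl⟩
      have h₁ := hle v hv hv0 y
      have h₂ := hv y z
      linarith
    linarith
  have hφx : φ x = 0 := by
    refine le_antisymm (csSup_le (hne x) ?_) ?_
    · rintro r ⟨v, -, hv0, rfl⟩
      exact hv0.le
    · simpa using hle _ (hu.sub_const (u x)) (by simp) x
  refine ⟨φ, hdom, fun y hy => ?_⟩
  intro ε hε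
  by_contra! hcon
  have hψ : Dominated c α (Function.update φ y (φ y + ε)) := by
    intro a b
    have hab := hdom a b
    by_cases ha : a = y <;> by_cases hb : b = y
    · subst ha; subst hb
      simp only [Function.update_self]
      linarith
    · subst ha
      simp only [Function.update_self, Function.update_of_ne hb]
      linarith
    · subst hb
      simp only [Function.update_self, Function.update_of_ne ha]
      linarith [hcon a]
    · simpa only [Function.update_of_ne ha, Function.update_of_ne hb] using hab
  have := hle _ hψ (by rw [Function.update_of_ne hy.symm, hφx]) y
  rw [Function.update_self] at this
  linarith

/-- If some chain of iterates gains one unit, the domination constant can be lowered. -/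
lemma exists_dominated_lt_of_gain {v : ℕ → X → ℝ}
    (hstep : ∀ k x y, v (k + 1) y ≤ v k x + c x y + α) {n : ℕ} (hn : 0 < n)
    (hgain : ∀ x, v 0 x + 1 ≤ v n x) : ∃ w : X → ℝ, Dominated c (α - 1 / n) w := by
  have hne : (Finset.range n).Nonempty := ⟨0, Finset.mem_range.2 hn⟩
  have hn' : (0 : ℝ) < n := by exact_mod_cast hn
  refine ⟨fun x => (Finset.range n).inf' hne fun k => v k x - k * (1 / n), fun x y => ?_⟩
  obtain ⟨k, hk, hkx⟩ := Finset.exists_mem_eq_inf' hne fun k : ℕ => v k x - k * (1 / (n : ℝ))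
  simp only [hkx]
  have hk' := Finset.mem_range.1 hk
  have hs := hstep k x y
  rcases Nat.lt_or_ge (k + 1) n with h | h
  · have := Finset.inf'_le (fun k : ℕ => v k y - k * (1 / (n : ℝ))) (Finset.mem_range.2 h)
    push_cast at this
    linarith
  · obtain rfl : n = k + 1 := by omega
    have h0 := Finset.inf'_le (fun j : ℕ => v j y - j * (1 / ((k + 1 : ℕ) : ℝ)))
      (Finset.mem_range.2 hn)
    have h1 := hgain y
    have h2 : ((k : ℝ) + 1) * (1 / ((k + 1 : ℕ) : ℝ)) = 1 := by
      push_cast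
      field_simp
    simp only [Nat.cast_zero, zero_mul, sub_zero] at h0
    linarith

lemma dominated_flip_neg : Dominated (fun x y => c y x) α (fun x => -u x) ↔ Dominated c α u := by
  constructor <;>
  · intro h x y
    have := h y x
    simp only at this ⊢
    linarith

lemma critValue_flip (c : X → X → ℝ) : critValue (fun x y => c y x) = critValue c := by
  unfold critValue
  congr 1
  ext α
  constructor
  · rintro ⟨u, hu⟩
    exact ⟨fun x => -u x, dominated_flip_neg.1 (by simpa using hu)⟩
  · rintro ⟨u, hu⟩
    exact ⟨fun x => -u x, dominated_flip_neg.2 hu⟩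

lemma Tp_neg (c : X → X → ℝ) (u : X → ℝ) (x : X) :
    Tp c (fun y => -u y) x = -Tm (fun x y => c y x) u x := by
  unfold Tp Tm
  rw [iInf, ← Real.sSup_neg, iSup]
  congr 1
  ext r
  simp only [Set.mem_range, Set.mem_neg]
  constructor <;> rintro ⟨y, hy⟩ <;> exact ⟨y, by linarith⟩

end Domination

section Metric

variable {X : Type*} [MetricSpace X] {c : X → X → ℝ} {B K α : ℝ}

/-- Along a chain with steps at most `K`, a function increasing by at most `A` at scale `2K`
increases by at most `A` per length `K`, up to one extra `A`. -/
lemma sub_le_of_chain {u : X → ℝ} {A : ℝ} (hK : 0 < K) (hA : 0 ≤ A)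
    (hu : ∀ x y, dist x y ≤ 2 * K → u y - u x ≤ A) (p : ℕ → X) (n : ℕ)
    (hp : ∀ i < n, dist (p i) (p (i + 1)) ≤ K) :
    u (p n) - u (p 0) ≤ A * (1 + (∑ i ∈ Finset.range n, dist (p i) (p (i + 1))) / K) := by
  set S : ℕ → ℝ := fun n => ∑ i ∈ Finset.range n, dist (p i) (p (i + 1)) with hS
  have hSs : ∀ i, S (i + 1) = S i + dist (p i) (p (i + 1)) := fun i => Finset.sum_range_succ _ _
  have main : ∀ i ≤ n, ∃ q s, dist q (p i) ≤ S i - s ∧ S i - s ≤ K ∧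
      u q - u (p 0) ≤ A * (s / K) := by
    intro i
    induction i with
    | zero => exact fun _ => ⟨p 0, 0, by simp [hS], by simpa [hS] using hK.le, by simp⟩
    | succ i ih =>
      intro hi
      obtain ⟨q, s, h₁, h₂, h₃⟩ := ih (by omega)
      have hstep := hp i (by omega)
      have htri := dist_triangle q (p i) (p (i + 1))
      have hSi := hSs i
      by_cases h : S (i + 1) - s ≤ K
      · exact ⟨q, s, by linarith, h, h₃⟩
      · refine ⟨p (i + 1), S (i + 1), by simp, by simpa using hK.le, ?_⟩
        have hq := hu q (p (i + 1)) (by linarith)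
        have hle : s / K + 1 ≤ S (i + 1) / K := by
          rw [div_add_one hK.ne']
          gcongr
          linarith
        nlinarith [mul_le_mul_of_nonneg_left hle hA]
  obtain ⟨q, s, h₁, h₂, h₃⟩ := main n le_rfl
  have hq := hu q (p n) (by linarith)
  have hle : s / K ≤ S n / K := by
    gcongr
    linarith [dist_nonneg (x := q) (y := p n)]
  nlinarith [mul_le_mul_of_nonneg_left hle hA]

/-- Dominated functions are uniformly Lipschitz in the large. -/
lemma exists_growth_bound (hK : 0 < K) (hlen : IsBLengthSpaceAtScale X B K)
    (hub : UniformlyBounded c) (α : ℝ) :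
    ∃ L M : ℝ, 0 ≤ L ∧ ∀ u, Dominated c α u → ∀ x y, u y - u x ≤ M + L * dist x y := by
  obtain ⟨A₀, hA₀⟩ := hub (2 * K)
  set A := max 0 (A₀ + α) with hA
  have hA0 : 0 ≤ A := le_max_left _ _
  refine ⟨max 0 (A * B / K), A, le_max_left _ _, fun u hu x y => ?_⟩
  obtain ⟨n, p, rfl, rfl, hp, hsum⟩ := hlen x y
  have h := sub_le_of_chain hK hA0 (u := u) (fun x y hxy => by
    linarith [hu x y, hA₀ x y hxy, le_max_right 0 (A₀ + α)]) p n hp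
  have h₂ : (∑ i ∈ Finset.range n, dist (p i) (p (i + 1))) / K ≤ B * dist (p 0) (p n) / K := by
    gcongr
  calc u (p n) - u (p 0) ≤ A * (1 + B * dist (p 0) (p n) / K) := by
        refine h.trans ?_
        gcongr
    _ = A + A * B / K * dist (p 0) (p n) := by ring
    _ ≤ _ := by
        gcongr
        exact le_max_right _ _

/-- Almost optimal points in the Lax-Oleinik infimum stay at uniformly bounded distance. -/
lemma exists_radius (hK : 0 < K) (hlen : IsBLengthSpaceAtScale X B K)
    (hsl : UniformlySuperlinear c) (hub : UniformlyBounded c) (α : ℝ) :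
    ∃ R : ℝ, ∀ u, Dominated c α u → ∀ x z, u z + c z x ≤ u x + c x x + 1 → dist z x ≤ R := by
  obtain ⟨L, M, hL, hLM⟩ := exists_growth_bound hK hlen hub α
  obtain ⟨C, hC⟩ := hsl (L + 1) (by linarith)
  obtain ⟨A, hA⟩ := hub 0
  refine ⟨M + C + A + 1, fun u hu x z hz => ?_⟩
  have h₁ := hLM u hu z x
  have h₂ := hC z x
  have h₃ := hA x x (by simp)
  linarith

lemma bddBelow_range_add_cost (hK : 0 < K) (hlen : IsBLengthSpaceAtScale X B K)
    (hsl : UniformlySuperlinear c) (hub : UniformlyBounded c) {u : X → ℝ}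
    (hu : Dominated c α u) (x : X) : BddBelow (range fun y => u y + c y x) := by
  obtain ⟨L, M, hL, hLM⟩ := exists_growth_bound hK hlen hub α
  obtain ⟨C, hC⟩ := hsl L hL
  refine ⟨u x - M - C, ?_⟩
  rintro _ ⟨y, rfl⟩
  have h₁ := hLM u hu y x
  have h₂ := hC y x
  simp only
  linarith

lemma nonempty_dominated (hsl : UniformlySuperlinear c) :
    {α : ℝ | ∃ u : X → ℝ, Dominated c α u}.Nonempty := by
  obtain ⟨C, hC⟩ := hsl 0 le_rfl
  exact ⟨C, fun _ => 0, fun x y => by linarith [hC x y]⟩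

lemma Dominated.eq_Tm_add (hK : 0 < K) (hlen : IsBLengthSpaceAtScale X B K)
    (hsl : UniformlySuperlinear c) (hub : UniformlyBounded c) {u : X → ℝ}
    (hu : Dominated c α u) {x : X} (hx : IsSupersolutionAt c α u u x) :
    u x = Tm c u x + α := by
  have : Nonempty X := ⟨x⟩
  apply le_antisymm
  · have : u x - α ≤ Tm c u x := le_ciInf fun y => by linarith [hu y x]
    linarith
  · refine le_of_forall_pos_le_add fun ε hε => ?_
    obtain ⟨z, hz⟩ := hx ε hε
    have : Tm c u x ≤ u z + c z x :=
      ciInf_le (bddBelow_range_add_cost hK hlen hsl hub hu x) z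
    linarith

variable [ProperSpace X]

/-- Local equicontinuity of the image of the Lax-Oleinik semigroup on dominated functions. -/
lemma exists_equicontinuity_radius (hK : 0 < K) (hlen : IsBLengthSpaceAtScale X B K)
    (hcont : Continuous fun q : X × X => c q.1 q.2)
    (hsl : UniformlySuperlinear c) (hub : UniformlyBounded c) (α : ℝ) (y : X) {ε : ℝ}
    (hε : 0 < ε) :
    ∃ δ > 0, δ ≤ 1 ∧ ∀ y', dist y' y < δ → ∀ u w : X → ℝ, Dominated c α u →
      (∀ z x, w x ≤ u z + c z x + α) → IsSupersolutionAt c α u w y →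
      IsSupersolutionAt c α u w y' → |w y' - w y| ≤ ε := by
  obtain ⟨R, hR⟩ := exists_radius hK hlen hsl hub α
  set D := closedBall y (max R 0 + 1) with hD
  have huc : UniformContinuousOn (fun q : X × X => c q.1 q.2) (D ×ˢ D) :=
    ((isCompact_closedBall y _).prod (isCompact_closedBall y _)).uniformContinuousOn_of_continuous
      hcont.continuousOn
  obtain ⟨δ, hδ, hδc⟩ := Metric.uniformContinuousOn_iff.1 huc (ε / 2) (by linarith)
  refine ⟨min δ 1, lt_min hδ one_pos, min_le_right _ _, ?_⟩
  intro y' hy' u w hu hw hy hy₂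
  have hyδ := hy'.trans_le (min_le_left _ _)
  have hy1 := hy'.trans_le (min_le_right _ _)
  have hRm := le_max_left R 0
  have hR0 := le_max_right R 0
  have hyD : y ∈ D := by simp only [hD, mem_closedBall, dist_self]; linarith
  have hyD' : y' ∈ D := by simp only [hD, mem_closedBall]; linarith
  have hnear : ∀ x, dist x y ≤ 1 → IsSupersolutionAt c α u w x →
      ∃ z ∈ D, u z + c z x + α ≤ w x + ε / 2 := by
    intro x hx hsup
    obtain ⟨z, hz⟩ := hsup (min (ε / 2) 1) (by positivity)
    refine ⟨z, ?_, hz.trans (by linarith [min_le_left (ε / 2) 1])⟩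
    have := hR u hu x z (by linarith [hw x x, min_le_right (ε / 2) 1])
    simp only [hD, mem_closedBall]
    linarith [dist_triangle z x y]
  have hcc : ∀ z ∈ D, |c z y' - c z y| < ε / 2 := by
    intro z hz
    have := hδc (z, y') ⟨hz, hyD'⟩ (z, y) ⟨hz, hyD⟩ (by simpa [Prod.dist_eq, hδ] using hyδ)
    simpa [Real.dist_eq] using this
  obtain ⟨z, hzD, hz⟩ := hnear y (by simp) hy
  obtain ⟨z', hzD', hz'⟩ := hnear y' hy1.le hy₂
  have h₁ := abs_lt.1 (hcc z hzD)
  have h₂ := abs_lt.1 (hcc z' hzD')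
  rw [abs_le]
  constructor <;> linarith [hw z y', hw z' y, h₁.1, h₁.2, h₂.1, h₂.2]

/-- Limits along an ultrafilter of asymptotically calibrated dominated functions are weak KAM
solutions. -/
lemma weakKAM_of_tendsto (hK : 0 < K) (hlen : IsBLengthSpaceAtScale X B K)
    (hcont : Continuous fun q : X × X => c q.1 q.2)
    (hsl : UniformlySuperlinear c) (hub : UniformlyBounded c)
    {ι : Type*} (F : Ultrafilter ι) {v w : ι → X → ℝ} {u : X → ℝ}
    (hv : ∀ i, Dominated c α (v i)) (hw : ∀ i z x, w i x ≤ v i z + c z x + α)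
    (hsup : ∀ x, ∀ᶠ i in F, IsSupersolutionAt c α (v i) (w i) x)
    (hequi : ∀ y, ∀ ε > 0, ∃ δ > 0, ∀ᶠ i in F, ∀ y', dist y' y < δ → |v i y' - v i y| ≤ ε)
    (hvu : ∀ x, Tendsto (fun i => v i x) F (𝓝 (u x)))
    (hwu : ∀ x, Tendsto (fun i => w i x) F (𝓝 (u x))) :
    Continuous u ∧ ∀ x, u x = Tm c u x + α := by
  have hu : Dominated c α u := fun x y =>
    le_of_tendsto ((hvu y).sub (hvu x)) (Eventually.of_forall fun i => hv i x y)
  constructor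
  · refine continuous_iff_continuousAt.2 fun y => Metric.continuousAt_iff.2 fun ε hε => ?_
    obtain ⟨δ, hδ, h⟩ := hequi y (ε / 2) (by linarith)
    refine ⟨δ, hδ, fun y' hy' => ?_⟩
    have := le_of_tendsto ((hvu y').sub (hvu y)).abs (h.mono fun i hi => hi y' hy')
    rw [Real.dist_eq]
    linarith
  · intro x
    refine hu.eq_Tm_add hK hlen hsl hub fun ε hε => ?_
    obtain ⟨R, hR⟩ := exists_radius hK hlen hsl hub α
    have hpt : ∀ i, ∃ z, IsSupersolutionAt c α (v i) (w i) x →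
        z ∈ closedBall x R ∧ v i z + c z x + α ≤ w i x + ε / 2 := by
      intro i
      by_cases h : IsSupersolutionAt c α (v i) (w i) x
      · obtain ⟨z, hz⟩ := h (min (ε / 2) 1) (by positivity)
        refine ⟨z, fun _ => ⟨?_, hz.trans (by linarith [min_le_left (ε / 2) 1])⟩⟩
        exact hR _ (hv i) x z (by linarith [hw i x x, min_le_right (ε / 2) 1])
      · exact ⟨x, fun h' => absurd h' h⟩
    choose p hp using hpt
    obtain ⟨z, -, hz⟩ := (isCompact_closedBall x R).ultrafilter_le_nhds (F.map p) (by
      rw [le_principal_iff]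
      exact Filter.mem_map.2 ((hsup x).mono fun i hi => (hp i hi).1))
    have hz' : Tendsto p F (𝓝 z) := hz
    obtain ⟨δ, hδ, hδv⟩ := hequi z (ε / 2) (by linarith)
    refine ⟨z, ?_⟩
    have hcz : Tendsto (fun i => c (p i) x) F (𝓝 (c z x)) :=
      (hcont.tendsto (z, x)).comp (hz'.prodMk_nhds tendsto_const_nhds)
    refine le_of_tendsto_of_tendsto (((hvu z).add hcz).add_const α) ((hwu x).add_const ε) ?_
    filter_upwards [hsup x, hδv, hz' (Metric.ball_mem_nhds z hδ)] with i h₁ h₂ h₃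
    have h₄ := (hp i h₁).2
    have h₅ := abs_le.1 (h₂ (p i) h₃)
    linarith [h₅.1]

/-- Weak KAM solutions for an unbounded space, as limits of potentials based at points escaping
to infinity. -/
lemma exists_weakKAM_of_unbounded (hK : 0 < K) (hlen : IsBLengthSpaceAtScale X B K)
    (hcont : Continuous fun q : X × X => c q.1 q.2)
    (hsl : UniformlySuperlinear c) (hub : UniformlyBounded c) {u₀ : X → ℝ}
    (hu₀ : Dominated c α u₀) (o : X) (hunb : ∀ D : ℝ, ∃ x, D < dist x o) :
    ∃ u : X → ℝ, Continuous u ∧ ∀ x, u x = Tm c u x + α := by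
  choose s hs using fun n : ℕ => hunb n
  choose φ hφ hφs using fun n : ℕ => exists_dominated_isSupersolutionAt_of_ne hu₀ (s n)
  set v : ℕ → X → ℝ := fun n x => φ n x - φ n o with hv
  have hvd : ∀ n, Dominated c α (v n) := fun n => (hφ n).sub_const _
  have hvs : ∀ n y, y ≠ s n → IsSupersolutionAt c α (v n) (v n) y := fun n y hy =>
    (hφs n y hy).sub_const _
  obtain ⟨u, hu⟩ := exists_tendsto_of_pointwise_bounded (hyperfilter ℕ) v fun x =>
    ⟨_, _, fun n => (hvd n).mem_Icc (o := o) (by simp [hv]) x⟩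
  have hfar : ∀ y : X, ∀ᶠ n in (hyperfilter ℕ : Filter ℕ), ∀ y', dist y' y ≤ 1 → y' ≠ s n := by
    intro y
    have := Nat.hyperfilter_le_atTop
      ((tendsto_natCast_atTop_atTop (R := ℝ)).eventually_ge_atTop (dist y o + 1))
    filter_upwards [this] with n hn y' hy' h
    have hn' : dist y o + 1 ≤ n := hn
    have h₁ := hs n
    rw [← h] at h₁
    linarith [dist_triangle y' y o]
  have hle : ∀ i z x, v i x ≤ v i z + c z x + α := fun i z x => by linarith [hvd i z x]
  refine ⟨u, weakKAM_of_tendsto hK hlen hcont hsl hub (hyperfilter ℕ) hvd hle ?_ ?_ hu hu⟩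
  · intro x
    filter_upwards [hfar x] with n hn using hvs n x (hn x (by simp))
  · intro y ε hε
    obtain ⟨δ, hδ, hδ1, h⟩ := exists_equicontinuity_radius hK hlen hcont hsl hub α y hε
    refine ⟨δ, hδ, ?_⟩
    filter_upwards [hfar y] with n hn y' hy'
    exact h y' hy' _ _ (hvd n) (hle n) (hvs n y (hn y (by simp)))
      (hvs n y' (hn y' (by linarith)))

/-- Critical weak KAM solutions for a bounded space, as limits of the Lax-Oleinik iterates. -/
lemma exists_weakKAM_of_bounded [Nonempty X] (hK : 0 < K) (hlen : IsBLengthSpaceAtScale X B K)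
    (hcont : Continuous fun q : X × X => c q.1 q.2)
    (hsl : UniformlySuperlinear c) (hub : UniformlyBounded c) {u₀ : X → ℝ}
    (hu₀ : Dominated c α u₀) {D : ℝ} (hD : ∀ x y : X, dist x y ≤ D)
    (hα : ∀ β < α, ¬∃ u : X → ℝ, Dominated c β u) :
    ∃ u : X → ℝ, Continuous u ∧ ∀ x, u x = Tm c u x + α := by
  set v : ℕ → X → ℝ := fun n => (fun f x => Tm c f x + α)^[n] u₀ with hv
  have hvs : ∀ n x, v (n + 1) x = Tm c (v n) x + α := fun n x => by
    simp only [hv, Function.iterate_succ_apply']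
  have hTle : ∀ f : X → ℝ, Dominated c α f → ∀ z x, Tm c f x + α ≤ f z + c z x + α :=
    fun f hf z x => by
      have : Tm c f x ≤ f z + c z x := ciInf_le (bddBelow_range_add_cost hK hlen hsl hub hf x) z
      linarith
  have hleT : ∀ f : X → ℝ, Dominated c α f → ∀ x, f x ≤ Tm c f x + α := fun f hf x => by
    have : f x - α ≤ Tm c f x := le_ciInf fun y => by linarith [hf y x]
    linarith
  have hvd : ∀ n, Dominated c α (v n) := by
    intro n
    induction n with
    | zero => exact hu₀
    | succ n ih =>
      intro x y
      rw [hvs, hvs]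
      linarith [hTle _ ih x y, hleT _ ih x]
  have hstep : ∀ n z x, v (n + 1) x ≤ v n z + c z x + α := fun n z x => by
    rw [hvs]; exact hTle _ (hvd n) z x
  have hmono : ∀ x, Monotone fun n => v n x := fun x => monotone_nat_of_le_succ fun n => by
    rw [hvs]; exact hleT _ (hvd n) x
  have hsup : ∀ n x, IsSupersolutionAt c α (v n) (v (n + 1)) x := fun n x => by
    have := isSupersolutionAt_Tm c α (v n) x
    rwa [← funext (hvs n)] at this
  obtain ⟨L, M, hL, hLM⟩ := exists_growth_bound hK hlen hub α
  have hosc : ∀ n x y, v n y - v n x ≤ M + L * D := fun n x y =>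
    (hLM _ (hvd n) x y).trans (by gcongr; exact hD x y)
  have hbdd : ∀ x, BddAbove (range fun n => v n x) := by
    by_contra! hcon
    obtain ⟨o, ho⟩ := hcon
    rw [not_bddAbove_iff] at ho
    obtain ⟨_, ⟨n, rfl⟩, hn⟩ := ho (max (v 0 o + 2 * (M + L * D) + 1) (v 0 o))
    have hn1 := (le_max_left _ _).trans_lt hn
    have hn0 : 0 < n := by
      rcases Nat.eq_zero_or_pos n with h | h
      · subst h
        exact absurd ((le_max_right _ _).trans_lt hn) (lt_irrefl _)
      · exact h
    refine hα (α - 1 / n) (sub_lt_self _ (by positivity))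
      (exists_dominated_lt_of_gain hstep hn0 fun x => ?_)
    linarith [hosc n x o, hosc 0 o x]
  have hlim : ∀ x, Tendsto (fun n => v n x) atTop (𝓝 (⨆ n, v n x)) := fun x =>
    tendsto_atTop_ciSup (hmono x) (hbdd x)
  refine ⟨fun x => ⨆ n, v n x, weakKAM_of_tendsto hK hlen hcont hsl hub (hyperfilter ℕ)
    (v := v) (w := fun n => v (n + 1)) hvd hstep
    (fun x => Eventually.of_forall fun n => hsup n x) ?_
    (fun x => (hlim x).mono_left Nat.hyperfilter_le_atTop)
    (fun x => ((tendsto_add_atTop_iff_nat 1).2 (hlim x)).mono_left Nat.hyperfilter_le_atTop)⟩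
  intro y ε hε
  obtain ⟨δ, hδ, -, h⟩ := exists_equicontinuity_radius hK hlen hcont hsl hub α y hε
  refine ⟨δ, hδ, Nat.hyperfilter_le_atTop ?_⟩
  filter_upwards [eventually_ge_atTop 1] with n hn y' hy'
  obtain ⟨k, rfl⟩ := Nat.exists_eq_add_of_le' hn
  exact h y' hy' _ _ (hvd k) (hstep k) (hsup k y) (hsup k y')

/-- There is a continuous negative weak KAM solution at the critical value. -/
lemma exists_weakKAM_critValue [Nonempty X] (hK : 0 < K) (hlen : IsBLengthSpaceAtScale X B K)
    (hcont : Continuous fun q : X × X => c q.1 q.2)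
    (hsl : UniformlySuperlinear c) (hub : UniformlyBounded c) :
    ∃ u : X → ℝ, Continuous u ∧ ∀ x, u x = Tm c u x + critValue c := by
  obtain ⟨u₀, hu₀⟩ := exists_dominated_critValue (nonempty_dominated hsl)
  obtain ⟨o⟩ := id ‹Nonempty X›
  by_cases h : ∀ D : ℝ, ∃ x, D < dist x o
  · exact exists_weakKAM_of_unbounded hK hlen hcont hsl hub hu₀ o h
  · push Not at h
    obtain ⟨D, hD⟩ := h
    refine exists_weakKAM_of_bounded hK hlen hcont hsl hub hu₀ (D := D + D)
      (fun x y => ?_) fun β hβ hex => not_le.2 hβ (csInf_le (bddBelow_dominated c) hex)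
    linarith [dist_triangle_right x y o, hD x, hD y]

end Metric

theorem weak_KAM_theorem {X : Type*} [MetricSpace X] [Nonempty X] [ProperSpace X]
    {B K : ℝ} (hB : 1 ≤ B) (hK : 0 < K) (hlen : IsBLengthSpaceAtScale X B K)
    {c : X → X → ℝ} (hcont : Continuous fun q : X × X => c q.1 q.2)
    (hsl : UniformlySuperlinear c) (hub : UniformlyBounded c) :
    ∃ α0 : ℝ,
      (∃ u : X → ℝ, Continuous u ∧ ∀ x, u x = Tm c u x + α0) ∧
      (∃ v : X → ℝ, Continuous v ∧ ∀ x, v x = Tp c v x - α0) ∧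
      ∀ α : ℝ, α < α0 → ¬∃ u : X → ℝ, Dominated c α u := by
  refine ⟨critValue c, exists_weakKAM_critValue hK hlen hcont hsl hub, ?_, fun α hα hex =>
    not_le.2 hα (csInf_le (bddBelow_dominated c) hex)⟩
  obtain ⟨u, hu, hfix⟩ := exists_weakKAM_critValue (c := fun x y => c y x) hK hlen
    (hcont.comp continuous_swap)
    (fun k hk => (hsl k hk).imp fun C hC x y => by rw [dist_comm]; exact hC y x)
    (fun R => (hub R).imp fun A hA x y hxy => hA y x (by rwa [dist_comm]))
  refine ⟨fun x => -u x, hu.neg, fun x => ?_⟩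
  have hx := hfix x
  rw [critValue_flip] at hx
  rw [Tp_neg]
  linarith
end

section
/- For every critical sub-solution u there exists a continuous critical sub-solution u' such that u'(y) − u'(x) < c(x,y) + α[0] for every pair (x,y) ∈ X² ∖ Â_u, and u' = u on A_u. Moreover, there exists a continuous critical sub-solution which satisfies u'(y) − u'(x) < c(x,y) + α[0] for every pair (x,y) ∈ X² ∖ Â. -/
open Metric Set Filter Topology

/-- A function whose increments at scale `2 * K` are bounded grows at most linearly. -/
theorem IsBLengthSpaceAtScale.sub_le_linear {X : Type*} [MetricSpace X] {B K A : ℝ} (hK : 0 < K)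
    (hlen : IsBLengthSpaceAtScale X B K) (hA : 0 ≤ A) {u : X → ℝ}
    (hu : ∀ x y, dist x y ≤ 2 * K → u y - u x ≤ A) (x y : X) :
    u y - u x ≤ A / K * B * dist x y + A := by
  obtain ⟨n, p, rfl, rfl, hstep, hsum⟩ := hlen x y
  have key : ∀ i ≤ n, ∃ z : X, ∃ s t : ℝ,
      s + t = ∑ j ∈ Finset.range i, dist (p j) (p (j + 1)) ∧ dist z (p i) ≤ t ∧ t ≤ K ∧
      u z - u (p 0) ≤ A / K * s := by
    intro i
    induction i with
    | zero => exact fun _ => ⟨p 0, 0, 0, by simp, by simp, hK.le, by simp⟩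
    | succ i ih =>
      intro hi
      obtain ⟨z, s, t, hst, hz, ht, hzu⟩ := ih (by omega)
      have hd := hstep i (by omega)
      have htri := dist_triangle z (p i) (p (i + 1))
      by_cases h : t + dist (p i) (p (i + 1)) ≤ K
      · refine ⟨z, s, t + dist (p i) (p (i + 1)), ?_, by linarith, h, hzu⟩
        rw [Finset.sum_range_succ, ← hst]; ring
      · push Not at h
        refine ⟨p (i + 1), s + (t + dist (p i) (p (i + 1))), 0, ?_, by simp, hK.le, ?_⟩
        · rw [Finset.sum_range_succ, ← hst]; ring
        · have h1 := hu z (p (i + 1)) (by linarith)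
          have h2 : A / K * K ≤ A / K * (t + dist (p i) (p (i + 1))) := by gcongr
          rw [div_mul_cancel₀ _ hK.ne'] at h2
          linarith
  obtain ⟨z, s, t, hst, hz, ht, hzu⟩ := key n le_rfl
  have ht0 : 0 ≤ t := dist_nonneg.trans hz
  have h1 := hu z (p n) (by linarith)
  have h2 : A / K * s ≤ A / K * (B * dist (p 0) (p n)) := by gcongr; linarith
  linarith

/-- Dominated functions have at most linear growth, uniformly. -/
theorem exists_dominated_growth {X : Type*} [MetricSpace X] {B K : ℝ} (hB : 1 ≤ B) (hK : 0 < K)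
    (hlen : IsBLengthSpaceAtScale X B K) {c : X → X → ℝ} (hub : UniformlyBounded c) (α : ℝ) :
    ∃ k D : ℝ, 0 ≤ k ∧ 0 ≤ D ∧ ∀ β ≤ α, ∀ u : X → ℝ, Dominated c β u →
      ∀ x y, u y - u x ≤ k * dist x y + D := by
  obtain ⟨A, hA⟩ := hub (2 * K)
  refine ⟨max (A + α) 0 / K * B, max (A + α) 0, by positivity, by positivity,
    fun β hβ u hu => hlen.sub_le_linear hK (le_max_right _ _) fun x y hxy => ?_⟩
  have := hu x y
  have := hA x y hxy
  have := le_max_left (A + α) 0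
  linarith

/-- Costs of long steps dominate the increments of dominated functions. -/
theorem exists_dominated_coercive {X : Type*} [MetricSpace X] {B K : ℝ} (hB : 1 ≤ B) (hK : 0 < K)
    (hlen : IsBLengthSpaceAtScale X B K) {c : X → X → ℝ} (hsl : UniformlySuperlinear c)
    (hub : UniformlyBounded c) (α : ℝ) :
    ∃ R : ℝ, ∀ u : X → ℝ, Dominated c α u →
      ∀ x y, R < dist y x → u x + c x x + 1 ≤ u y + c y x := by
  obtain ⟨k, D, hk, hD, hgrow⟩ := exists_dominated_growth hB hK hlen hub α
  obtain ⟨C, hC⟩ := hsl (k + 1) (by linarith)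
  obtain ⟨A, hA⟩ := hub 0
  refine ⟨A + C + D + 1, fun u hu x y hxy => ?_⟩
  have h1 := hgrow α le_rfl u hu y x
  have h2 := hC y x
  have h3 := hA x x (by simp)
  linarith

/-- There is a critical sub-solution. -/
theorem exists_dominated_critValue_s1 {X : Type*} [MetricSpace X] [Nonempty X] {B K : ℝ}
    (hB : 1 ≤ B) (hK : 0 < K) (hlen : IsBLengthSpaceAtScale X B K) {c : X → X → ℝ}
    (hsl : UniformlySuperlinear c) (hub : UniformlyBounded c) :
    ∃ u : X → ℝ, Dominated c (critValue c) u := by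
  obtain ⟨x₀⟩ := ‹Nonempty X›
  have hne : {α : ℝ | ∃ u : X → ℝ, Dominated c α u}.Nonempty := by
    obtain ⟨C, hC⟩ := hsl 0 le_rfl
    refine ⟨C, 0, fun x y => ?_⟩
    have := hC x y
    simp only [Pi.zero_apply]
    linarith
  obtain ⟨k, D, hk, hD, hgrow⟩ := exists_dominated_growth hB hK hlen hub (critValue c + 1)
  set ε : ℕ → ℝ := fun n => 1 / ((n : ℝ) + 1) with hε
  have hε1 : ∀ n, ε n ≤ 1 := fun n => by
    rw [hε]; simp only
    rw [div_le_one (by positivity)]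
    linarith [(Nat.cast_nonneg n : (0 : ℝ) ≤ n)]
  have hε0 : ∀ n, 0 < ε n := fun n => by positivity
  let P : Set (X → ℝ) := Set.univ.pi fun x => Icc (-(k * dist x₀ x + D)) (k * dist x₀ x + D)
  let t : ℕ → Set (X → ℝ) := fun n => P ∩ {u | Dominated c (critValue c + ε n) u}
  have hP : IsCompact P := isCompact_univ_pi fun x => isCompact_Icc
  have hcl : ∀ β, IsClosed {u : X → ℝ | Dominated c β u} := fun β => by
    have : {u : X → ℝ | Dominated c β u} = ⋂ x, ⋂ y, {u | u y - u x ≤ c x y + β} := by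
      ext u; simp [Dominated]
    rw [this]
    exact isClosed_iInter fun x => isClosed_iInter fun y =>
      isClosed_le (by fun_prop) continuous_const
  have hbelow : BddBelow {α : ℝ | ∃ u : X → ℝ, Dominated c α u} := by
    refine ⟨-c x₀ x₀, ?_⟩
    rintro α ⟨u, hu⟩
    have := hu x₀ x₀
    linarith
  obtain ⟨u, hu⟩ := IsCompact.nonempty_iInter_of_sequence_nonempty_isCompact_isClosed t
    (fun n u hu => ⟨hu.1, fun x y => (hu.2 x y).trans (by
      have : ε (n + 1) ≤ ε n := Nat.one_div_le_one_div n.le_succ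
      linarith)⟩)
    (fun n => by
      obtain ⟨α, ⟨u, hu⟩, hα⟩ := exists_lt_of_csInf_lt hne
        (show sInf _ < critValue c + ε n from lt_add_of_pos_right _ (hε0 n))
      have hg := hgrow α (by linarith [hε1 n]) u hu
      refine ⟨fun x => u x - u x₀, fun x _ => ⟨?_, hg x₀ x⟩, fun x y => ?_⟩
      · have := hg x x₀
        rw [dist_comm] at this
        simp only
        linarith
      · have := hu x y
        simp only
        linarith)
    (hP.inter_right (hcl _)) (fun n => hP.isClosed.inter (hcl _))
  rw [mem_iInter] at hu
  refine ⟨u, fun x y => ge_of_tendsto' (x := atTop) (f := fun n => c x y + (critValue c + ε n)) ?_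
    fun n => (hu n).2 x y⟩
  simpa [hε] using (tendsto_one_div_add_atTop_nhds_zero_nat.const_add (critValue c)).const_add (c x y)

/-- Countable convex combinations of dominated functions: the resulting function is strict
wherever one of the terms is. -/
theorem exists_dominated_of_sequence {X : Type*} [MetricSpace X] {c : X → X → ℝ} {α : ℝ}
    {v : ℕ → X → ℝ} (hv : ∀ n, Continuous (v n)) (hd : ∀ n, Dominated c α (v n)) {g : X → ℝ}
    (hg : Continuous g) (hvg : ∀ n x, |v n x| ≤ (n + 1) * g x) :
    ∃ w : X → ℝ, Continuous w ∧ Dominated c α w ∧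
      (∀ x y, w y - w x = c x y + α → ∀ n, v n y - v n x = c x y + α) ∧
      ∀ x a, (∀ n, v n x = a) → w x = a := by
  set q : ℕ → ℝ := fun n => (1 / 2) ^ (n + 1) with hq
  have hq0 : ∀ n, 0 < q n := fun n => by positivity
  have hq1 : HasSum q 1 := by
    have := hasSum_geometric_two.mul_left (1 / 2 : ℝ)
    simpa [hq, pow_succ'] using this
  have hqs : Summable fun n : ℕ => q n * (n + 1) := by
    have h := (summable_pow_mul_geometric_of_norm_lt_one 1
      (show ‖(1 / 2 : ℝ)‖ < 1 by norm_num))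
    have h' := (summable_nat_add_iff 1).2 h
    refine h'.congr fun n => ?_
    simp [hq]; ring
  have hle : ∀ n x, ‖q n * v n x‖ ≤ q n * (n + 1) * g x := fun n x => by
    rw [norm_mul, Real.norm_of_nonneg (hq0 n).le, mul_assoc]
    exact mul_le_mul_of_nonneg_left (hvg n x) (hq0 n).le
  have hs : ∀ x, Summable fun n => q n * v n x := fun x =>
    Summable.of_norm_bounded (hqs.mul_right (g x)) fun n => hle n x
  have hdiff : ∀ x y, HasSum (fun n => q n * (v n y - v n x))
      ((∑' n, q n * v n y) - ∑' n, q n * v n x) := fun x y => by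
    simpa only [mul_sub] using (hs y).hasSum.sub (hs x).hasSum
  have hconst : ∀ a : ℝ, HasSum (fun n => q n * a) a := fun a => by
    simpa using hq1.mul_right a
  have hterm : ∀ x y n, q n * (v n y - v n x) ≤ q n * (c x y + α) := fun x y n =>
    mul_le_mul_of_nonneg_left (hd n x y) (hq0 n).le
  refine ⟨fun x => ∑' n, q n * v n x, ?_, ?_, ?_, ?_⟩
  · rw [continuous_iff_continuousAt]
    intro x
    have hU : {y | g y < g x + 1} ∈ 𝓝 x :=
      (isOpen_lt hg continuous_const).mem_nhds (by simp)
    refine (continuousOn_tsum (u := fun n => q n * (n + 1) * (g x + 1))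
      (fun n => ((hv n).const_smul (q n)).continuousOn) (hqs.mul_right _)
      fun n y hy => (hle n y).trans ?_).continuousAt hU
    have hy' : g y < g x + 1 := hy
    have := hq0 n
    gcongr
  · exact fun x y => hasSum_le (hterm x y) (hdiff x y) (hconst _)
  · intro x y hxy
    by_contra! h
    obtain ⟨n, hn⟩ := h
    exact (hasSum_lt (hterm x y)
      (mul_lt_mul_of_pos_left (lt_of_le_of_ne (hd n x y) hn) (hq0 n))
      (hdiff x y) (hconst _)).ne hxy
  · intro x a hxa
    simpa only [hxa] using (hconst a).tsum_eq

/-- The Lax-Oleinik operator for the shifted cost `c + α`. -/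
noncomputable def laxOleinik {X : Type*} (c : X → X → ℝ) (α : ℝ) (u : X → ℝ) (x : X) : ℝ :=
  ⨅ y, (u y + c y x + α)

section LaxOleinik

variable {X : Type*} {c : X → X → ℝ} {α : ℝ} {u : X → ℝ}

theorem laxOleinik_le (hu : Dominated c α u) (x y : X) :
    laxOleinik c α u x ≤ u y + c y x + α :=
  ciInf_le ⟨u x, by rintro _ ⟨z, rfl⟩; have := hu z x; simp only; linarith⟩ y

theorem le_laxOleinik (hu : Dominated c α u) (x : X) : u x ≤ laxOleinik c α u x :=
  have : Nonempty X := ⟨x⟩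
  le_ciInf fun y => by have := hu y x; linarith

theorem dominated_laxOleinik (hu : Dominated c α u) : Dominated c α (laxOleinik c α u) :=
  fun x y => by have := laxOleinik_le hu y x; have := le_laxOleinik hu x; linarith

theorem dominated_iterate_laxOleinik (hu : Dominated c α u) (n : ℕ) :
    Dominated c α ((laxOleinik c α)^[n] u) := by
  induction n with
  | zero => exact hu
  | succ n ih => rw [Function.iterate_succ_apply']; exact dominated_laxOleinik ih

theorem monotone_iterate_laxOleinik (hu : Dominated c α u) (x : X) :
    Monotone fun n => (laxOleinik c α)^[n] u x :=
  monotone_nat_of_le_succ fun n => by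
    rw [Function.iterate_succ_apply']
    exact le_laxOleinik (dominated_iterate_laxOleinik hu n) x

theorem le_iterate_laxOleinik (hu : Dominated c α u) (n : ℕ) (x : X) :
    u x ≤ (laxOleinik c α)^[n] u x :=
  monotone_iterate_laxOleinik hu x (Nat.zero_le n)

theorem iterate_laxOleinik_le_add {A : ℝ} (hA : ∀ x, c x x + α ≤ A) (hu : Dominated c α u)
    (n : ℕ) (x : X) : (laxOleinik c α)^[n] u x ≤ u x + n * A := by
  induction n with
  | zero => simp
  | succ n ih =>
    rw [Function.iterate_succ_apply']
    have h1 := laxOleinik_le (dominated_iterate_laxOleinik hu n) x x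
    have h2 := hA x
    push_cast
    linarith

/-- A point is the endpoint of an infinite backward calibrated chain. -/
def HasBackwardChain (c : X → X → ℝ) (α : ℝ) (u : X → ℝ) (x : X) : Prop :=
  ∃ p : ℕ → X, p 0 = x ∧ ∀ n, u (p n) = u (p (n + 1)) + c (p (n + 1)) (p n) + α

theorem HasBackwardChain.iterate_laxOleinik_eq (hu : Dominated c α u) {x : X}
    (h : HasBackwardChain c α u x) (n : ℕ) : (laxOleinik c α)^[n] u x = u x := by
  obtain ⟨p, rfl, hp⟩ := h
  suffices H : ∀ m, (laxOleinik c α)^[n] u (p m) ≤ u (p m) from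
    le_antisymm (H 0) (le_iterate_laxOleinik hu n _)
  induction n with
  | zero => exact fun m => le_rfl
  | succ n ih =>
    intro m
    rw [Function.iterate_succ_apply']
    have h1 := laxOleinik_le (dominated_iterate_laxOleinik hu n) (p m) (p (m + 1))
    have h2 := ih (m + 1)
    have h3 := hp m
    linarith

variable [MetricSpace X] [ProperSpace X]

theorem continuous_laxOleinik (hcont : Continuous fun q : X × X => c q.1 q.2) {R : ℝ}
    (hR : ∀ x y, R < dist y x → u x + c x x + 1 ≤ u y + c y x) (hu : Dominated c α u) :
    Continuous (laxOleinik c α u) := by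
  rw [Metric.continuous_iff']
  intro x₀ ε hε
  set δ := min (ε / 2) 1 with hδ
  have hδ0 : 0 < δ := by positivity
  have hδε : δ ≤ ε / 2 := min_le_left _ _
  have hδ1 : δ ≤ 1 := min_le_right _ _
  have h1 : ∀ᶠ x in 𝓝 x₀, ∀ y ∈ closedBall x₀ (|R| + 1), |c y x - c y x₀| < δ := by
    refine (isCompact_closedBall x₀ (|R| + 1)).eventually_forall_of_forall_eventually
      fun y _ => ?_
    have hc : Continuous fun z : X × X => |c z.2 z.1 - c z.2 x₀| :=
      ((hcont.comp (continuous_snd.prodMk continuous_fst)).sub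
        (hcont.comp (continuous_snd.prodMk continuous_const))).abs
    exact (hc.tendsto (x₀, y)).eventually_lt_const (by simpa using hδ0)
  filter_upwards [h1, Metric.ball_mem_nhds x₀ one_pos] with x hx hx1
  have hx1 : dist x x₀ < 1 := hx1
  have hRa := le_abs_self R
  have hR0 := abs_nonneg R
  have hnon : Nonempty X := ⟨x⟩
  have hcx := abs_lt.1 (hx x (by rw [mem_closedBall]; linarith))
  have hcx₀ := abs_lt.1 (hx x₀ (by rw [mem_closedBall, dist_self]; linarith))
  have hA : laxOleinik c α u x - δ ≤ laxOleinik c α u x₀ := by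
    refine le_ciInf fun y => ?_
    by_cases hy : y ∈ closedBall x₀ (|R| + 1)
    · have := abs_lt.1 (hx y hy)
      have := laxOleinik_le hu x y
      linarith
    · rw [mem_closedBall, not_le] at hy
      have := hR x₀ y (by linarith)
      have := laxOleinik_le hu x x₀
      linarith
  have hB : laxOleinik c α u x₀ - δ ≤ laxOleinik c α u x := by
    refine le_ciInf fun y => ?_
    by_cases hy : y ∈ closedBall x₀ (|R| + 1)
    · have := abs_lt.1 (hx y hy)
      have := laxOleinik_le hu x₀ y
      linarith
    · rw [mem_closedBall, not_le] at hy
      have := dist_triangle y x x₀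
      have := hR x y (by linarith)
      have := laxOleinik_le hu x₀ x
      linarith
  rw [Real.dist_eq, abs_lt]
  constructor <;> linarith

theorem exists_laxOleinik_eq (hcont : Continuous fun q : X × X => c q.1 q.2) {R : ℝ}
    (hR : ∀ x y, R < dist y x → u x + c x x + 1 ≤ u y + c y x) (huc : Continuous u) (x : X) :
    ∃ y, laxOleinik c α u x = u y + c y x + α := by
  have hc : Continuous fun y => u y + c y x + α :=
    (huc.add (hcont.comp (continuous_id.prodMk continuous_const))).add continuous_const
  obtain ⟨y, hy⟩ := hc.exists_forall_le' x (by
    filter_upwards [(isCompact_closedBall x R).compl_mem_cocompact] with y hy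
    rw [mem_compl_iff, mem_closedBall, not_le] at hy
    have := hR x y hy
    linarith)
  have : Nonempty X := ⟨x⟩
  exact ⟨y, le_antisymm (ciInf_le ⟨_, by rintro _ ⟨z, rfl⟩; exact hy z⟩ y) (le_ciInf hy)⟩

theorem continuous_iterate_laxOleinik (hcont : Continuous fun q : X × X => c q.1 q.2) {R : ℝ}
    (hR : ∀ u : X → ℝ, Dominated c α u →
      ∀ x y, R < dist y x → u x + c x x + 1 ≤ u y + c y x)
    (hu : Dominated c α u) (huc : Continuous u) (n : ℕ) :
    Continuous ((laxOleinik c α)^[n] u) := by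
  cases n with
  | zero => exact huc
  | succ n =>
    rw [Function.iterate_succ']
    have := dominated_iterate_laxOleinik hu n
    exact continuous_laxOleinik hcont (hR _ this) this

/-- Points fixed by all iterates of the Lax-Oleinik operator have a calibrated predecessor of the
same kind. -/
theorem exists_predecessor (hcont : Continuous fun q : X × X => c q.1 q.2) {R : ℝ}
    (hR : ∀ u : X → ℝ, Dominated c α u →
      ∀ x y, R < dist y x → u x + c x x + 1 ≤ u y + c y x)
    (hu : Dominated c α u) (huc : Continuous u) {x : X}
    (hx : ∀ n, (laxOleinik c α)^[n] u x = u x) :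
    ∃ y, u x = u y + c y x + α ∧ ∀ n, (laxOleinik c α)^[n] u y = u y := by
  let t : ℕ → Set X := fun n =>
    {y | u x = u y + c y x + α} ∩ {y | (laxOleinik c α)^[n] u y = u y}
  have hcl : ∀ n, IsClosed (t n) := fun n =>
    (isClosed_eq continuous_const
      ((huc.add (hcont.comp (continuous_id.prodMk continuous_const))).add continuous_const)).inter
    (isClosed_eq (continuous_iterate_laxOleinik hcont hR hu huc n) huc)
  have hcomp : IsCompact (t 0) := by
    refine (isCompact_closedBall x R).of_isClosed_subset (hcl 0) fun y hy => ?_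
    rw [mem_closedBall]
    by_contra! h
    have h1 := hR u hu x y h
    have h2 : u x = u y + c y x + α := hy.1
    have h3 := hu x x
    linarith
  obtain ⟨y, hy⟩ := IsCompact.nonempty_iInter_of_sequence_nonempty_isCompact_isClosed t
    (fun n y hy => ⟨hy.1, le_antisymm
      ((monotone_iterate_laxOleinik hu y n.le_succ).trans (le_of_eq hy.2))
      (le_iterate_laxOleinik hu n y)⟩)
    (fun n => by
      have hd := dominated_iterate_laxOleinik hu n
      obtain ⟨y, hy⟩ := exists_laxOleinik_eq (α := α) hcont (hR _ hd)
        (continuous_iterate_laxOleinik hcont hR hu huc n) x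
      rw [← Function.iterate_succ_apply' (laxOleinik c α), hx] at hy
      have h1 := le_iterate_laxOleinik hu n y
      have h2 := hu y x
      exact ⟨y, show u x = u y + c y x + α by linarith,
        show (laxOleinik c α)^[n] u y = u y by linarith⟩)
    hcomp hcl
  rw [mem_iInter] at hy
  exact ⟨y, (hy 0).1, fun n => (hy n).2⟩

theorem hasBackwardChain_of_iterate_eq (hcont : Continuous fun q : X × X => c q.1 q.2) {R : ℝ}
    (hR : ∀ u : X → ℝ, Dominated c α u →
      ∀ x y, R < dist y x → u x + c x x + 1 ≤ u y + c y x)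
    (hu : Dominated c α u) (huc : Continuous u) {x : X}
    (hx : ∀ n, (laxOleinik c α)^[n] u x = u x) : HasBackwardChain c α u x := by
  choose f hf hf' using fun z : {z // ∀ n, (laxOleinik c α)^[n] u z = u z} =>
    exists_predecessor hcont hR hu huc z.2
  let F : {z // ∀ n, (laxOleinik c α)^[n] u z = u z} → {z // ∀ n, (laxOleinik c α)^[n] u z = u z} :=
    fun z => ⟨f z, hf' z⟩
  refine ⟨fun n => (F^[n] ⟨x, hx⟩).1, rfl, fun n => ?_⟩
  simp only [Function.iterate_succ_apply']
  exact hf _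

/-- A sub-solution that agrees with `u` at endpoints of backward calibrated chains, and is strict
at pairs which are strict for `u` or whose first point ends no such chain. -/
theorem exists_strict_of_not_hasBackwardChain {B K : ℝ} (hB : 1 ≤ B) (hK : 0 < K)
    (hlen : IsBLengthSpaceAtScale X B K) (hcont : Continuous fun q : X × X => c q.1 q.2)
    (hsl : UniformlySuperlinear c) (hub : UniformlyBounded c)
    (hu : Dominated c α u) (huc : Continuous u) :
    ∃ w : X → ℝ, Continuous w ∧ Dominated c α w ∧
      (∀ x y, w y - w x = c x y + α →
        u y - u x = c x y + α ∧ HasBackwardChain c α u x) ∧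
      ∀ x, HasBackwardChain c α u x → w x = u x := by
  obtain ⟨R, hR⟩ := exists_dominated_coercive hB hK hlen hsl hub α
  obtain ⟨A, hA⟩ := hub 0
  have hA' : ∀ x, c x x + α ≤ |A + α| := fun x => by
    have := hA x x (by simp)
    have := le_abs_self (A + α)
    linarith
  obtain ⟨w, hwc, hwd, hws, hwe⟩ := exists_dominated_of_sequence
    (v := fun n => (laxOleinik c α)^[n] u) (g := fun x => |u x| + |A + α|)
    (continuous_iterate_laxOleinik hcont hR hu huc) (dominated_iterate_laxOleinik hu)
    (by fun_prop) (fun n x => by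
      have h1 := le_iterate_laxOleinik hu n x
      have h2 := iterate_laxOleinik_le_add hA' hu n x
      have h3 := le_abs_self (u x)
      have h4 := neg_abs_le (u x)
      have h5 := abs_nonneg (A + α)
      have h6 : (0 : ℝ) ≤ n * |u x| := by positivity
      have h7 : (0 : ℝ) ≤ n * |A + α| := by positivity
      rw [abs_le]
      constructor <;> nlinarith)
  refine ⟨w, hwc, hwd, fun x y hxy => ⟨hws x y hxy 0, ?_⟩,
    fun x hx => hwe x _ (hx.iterate_laxOleinik_eq hu)⟩
  refine hasBackwardChain_of_iterate_eq hcont hR hu huc fun n => ?_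
  induction n with
  | zero => rfl
  | succ n ih =>
    refine le_antisymm ?_ (le_iterate_laxOleinik hu _ x)
    have h1 := hws x y hxy (n + 1)
    have h2 := laxOleinik_le (dominated_iterate_laxOleinik hu n) y x
    rw [← Function.iterate_succ_apply' (laxOleinik c α)] at h2
    linarith

end LaxOleinik

theorem isCalibrated_iff_step {X : Type*} {c : X → X → ℝ} {α : ℝ} {u : X → ℝ} {x : ℤ → X} :
    IsCalibrated c α u x ↔ ∀ m, u (x (m + 1)) = u (x m) + c (x m) (x (m + 1)) + α := by
  constructor
  · intro h m
    simpa using h m 1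
  · intro h m k
    induction k with
    | zero => simp
    | succ k ih =>
      have := h (m + k)
      rw [Finset.sum_range_succ]
      push_cast
      rw [← add_assoc, this, ih]
      ring

theorem hasBackwardChain_of_mem_projAubry {X : Type*} {c : X → X → ℝ} {u : X → ℝ} {p : X}
    (hp : p ∈ projAubry c u) : HasBackwardChain c (critValue c) u p := by
  obtain ⟨x, hx, rfl⟩ := hp
  rw [isCalibrated_iff_step] at hx
  refine ⟨fun n => x (-n), by simp, fun n => ?_⟩
  have h := hx (-(n : ℤ) - 1)
  rw [sub_add_cancel] at h
  have e : (-((n + 1 : ℕ) : ℤ)) = -(n : ℤ) - 1 := by push_cast; ring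
  simp only [e]
  exact h

theorem mem_projAubry_of_isCalibrated {X : Type*} {c : X → X → ℝ} {u : X → ℝ} {x : ℤ → X}
    (hx : IsCalibrated c (critValue c) u x) (m : ℤ) : x m ∈ projAubry c u := by
  refine ⟨fun n => x (n + m), ?_, by simp⟩
  rw [isCalibrated_iff_step] at hx ⊢
  intro n
  have := hx (n + m)
  rwa [add_right_comm] at this

/-- `-u` is dominated for the reversed cost. -/
theorem Dominated.neg_swap {X : Type*} {c : X → X → ℝ} {α : ℝ} {u : X → ℝ}
    (hu : Dominated c α u) : Dominated (fun x y => c y x) α fun x => -u x := fun x y => by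
  have := hu y x
  simp only
  linarith

theorem hasForwardChain_of_mem_projAubry {X : Type*} {c : X → X → ℝ} {u : X → ℝ} {p : X}
    (hp : p ∈ projAubry c u) :
    HasBackwardChain (fun x y => c y x) (critValue c) (fun x => -u x) p := by
  obtain ⟨x, hx, rfl⟩ := hp
  rw [isCalibrated_iff_step] at hx
  refine ⟨fun n => x n, by simp, fun n => ?_⟩
  have := hx n
  push_cast
  linarith

/-- A calibrated pair extending to calibrated chains in both directions lies in `Â_u`. -/
theorem mem_aubryPairs_of_chains {X : Type*} {c : X → X → ℝ} {u : X → ℝ} {x y : X}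
    (hxy : u y - u x = c x y + critValue c) (hx : HasBackwardChain c (critValue c) u x)
    (hy : HasBackwardChain (fun x y => c y x) (critValue c) (fun x => -u x) y) :
    (x, y) ∈ aubryPairs c u := by
  obtain ⟨p, rfl, hp⟩ := hx
  obtain ⟨q, rfl, hq⟩ := hy
  let z : ℤ → X := fun m => match m with
    | Int.ofNat n => q n
    | Int.negSucc n => p n
  refine ⟨z, -1, isCalibrated_iff_step.2 fun m => ?_, rfl, rfl⟩
  match m with
  | Int.ofNat n =>
    have h := hq n
    change u (q (n + 1)) = u (q n) + c (q n) (q (n + 1)) + critValue c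
    simp only at h
    linarith
  | Int.negSucc 0 =>
    change u (q 0) = u (p 0) + c (p 0) (q 0) + critValue c
    linarith
  | Int.negSucc (n + 1) => exact hp n

/-- One Lax-Oleinik step does not enlarge the set of Aubry pairs. -/
theorem aubryPairs_laxOleinik_subset {X : Type*} {c : X → X → ℝ} {u : X → ℝ}
    (hu : Dominated c (critValue c) u) :
    aubryPairs c (laxOleinik c (critValue c) u) ⊆ aubryPairs c u := by
  rintro ⟨a, b⟩ ⟨x, n, hx, hxa, hxb⟩
  refine ⟨x, n, ?_, hxa, hxb⟩
  rw [isCalibrated_iff_step] at hx ⊢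
  have h : ∀ m, u (x m) = laxOleinik c (critValue c) u (x m) := fun m => by
    have h1 := hx m
    have h2 := laxOleinik_le hu (x (m + 1)) (x m)
    have h3 := le_laxOleinik hu (x m)
    linarith
  intro m
  rw [h, h]
  exact hx m

theorem laxOleinik_eq_of_mem_projAubry {X : Type*} {c : X → X → ℝ} {u : X → ℝ}
    (hu : Dominated c (critValue c) u) {x : X} (hx : x ∈ projAubry c u) :
    laxOleinik c (critValue c) u x = u x :=
  (hasBackwardChain_of_mem_projAubry hx).iterate_laxOleinik_eq hu 1

theorem projAubry_subset_projAubry_laxOleinik {X : Type*} {c : X → X → ℝ} {u : X → ℝ}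
    (hu : Dominated c (critValue c) u) :
    projAubry c u ⊆ projAubry c (laxOleinik c (critValue c) u) := by
  rintro _ ⟨x, hx, rfl⟩
  refine ⟨x, ?_, rfl⟩
  have h := fun m => laxOleinik_eq_of_mem_projAubry hu (mem_projAubry_of_isCalibrated hx m)
  rw [isCalibrated_iff_step] at hx ⊢
  intro m
  rw [h, h]
  exact hx m

theorem exists_strict_off_aubryPairs {X : Type*} [MetricSpace X] [ProperSpace X]
    {B K : ℝ} (hB : 1 ≤ B) (hK : 0 < K) (hlen : IsBLengthSpaceAtScale X B K)
    {c : X → X → ℝ} (hcont : Continuous fun q : X × X => c q.1 q.2)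
    (hsl : UniformlySuperlinear c) (hub : UniformlyBounded c)
    {u : X → ℝ} (hu : Dominated c (critValue c) u) :
    ∃ u' : X → ℝ, Continuous u' ∧ Dominated c (critValue c) u' ∧
      (∀ x y : X, (x, y) ∉ aubryPairs c u → u' y - u' x < c x y + critValue c) ∧
      ∀ x ∈ projAubry c u, u' x = u x := by
  obtain ⟨R, hR⟩ := exists_dominated_coercive hB hK hlen hsl hub (critValue c)
  set u₁ := laxOleinik c (critValue c) u with hu₁
  have hd₁ : Dominated c (critValue c) u₁ := dominated_laxOleinik hu
  have hc₁ : Continuous u₁ := continuous_laxOleinik hcont (hR u hu) hu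
  have hsl' : UniformlySuperlinear fun x y => c y x := fun k hk => by
    obtain ⟨C, hC⟩ := hsl k hk
    exact ⟨C, fun x y => by rw [dist_comm]; exact hC y x⟩
  have hub' : UniformlyBounded fun x y => c y x := fun r => by
    obtain ⟨A, hA⟩ := hub r
    exact ⟨A, fun x y hxy => hA y x (by rwa [dist_comm])⟩
  obtain ⟨w, hwc, hwd, hws, hwe⟩ :=
    exists_strict_of_not_hasBackwardChain hB hK hlen hcont hsl hub hd₁ hc₁
  obtain ⟨v, hvc, hvd, hvs, hve⟩ :=
    exists_strict_of_not_hasBackwardChain (c := fun x y => c y x) hB hK hlen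
      (hcont.comp continuous_swap) hsl' hub' hd₁.neg_swap hc₁.neg
  refine ⟨fun x => (w x - v x) / 2, by fun_prop, fun x y => ?_, fun x y hxy => ?_, fun x hx => ?_⟩
  · have := hwd x y
    have := hvd y x
    simp only at *
    linarith
  · by_contra! h
    have h1 := hwd x y
    have h2 := hvd y x
    simp only at h h2
    obtain ⟨h3, h4⟩ := hws x y (by linarith)
    obtain ⟨-, h5⟩ := hvs y x (by linarith)
    exact hxy (aubryPairs_laxOleinik_subset hu (mem_aubryPairs_of_chains h3 h4 h5))
  · have hx₁ := projAubry_subset_projAubry_laxOleinik hu hx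
    have h1 := hwe x (hasBackwardChain_of_mem_projAubry hx₁)
    have h2 := hve x (hasForwardChain_of_mem_projAubry hx₁)
    have h3 := laxOleinik_eq_of_mem_projAubry hu hx
    simp only [h1, h2]
    linarith

theorem exists_strict_off_aubryPairsSet {X : Type*} [MetricSpace X] [Nonempty X] [ProperSpace X]
    {B K : ℝ} (hB : 1 ≤ B) (hK : 0 < K) (hlen : IsBLengthSpaceAtScale X B K)
    {c : X → X → ℝ} (hcont : Continuous fun q : X × X => c q.1 q.2)
    (hsl : UniformlySuperlinear c) (hub : UniformlyBounded c) :
    ∃ u' : X → ℝ, Continuous u' ∧ Dominated c (critValue c) u' ∧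
      ∀ x y : X, (x, y) ∉ aubryPairsSet c → u' y - u' x < c x y + critValue c := by
  obtain ⟨u₀, hu₀⟩ := exists_dominated_critValue_s1 hB hK hlen hsl hub
  obtain ⟨x₀⟩ := ‹Nonempty X›
  obtain ⟨k, D, hk, hD, hgrow⟩ := exists_dominated_growth hB hK hlen hub (critValue c)
  obtain ⟨v₀, hv₀c, hv₀d, -⟩ := exists_strict_off_aubryPairs hB hK hlen hcont hsl hub hu₀
  let I := {v : X → ℝ // Continuous v ∧ Dominated c (critValue c) v}
  let U : I → Set (X × X) := fun v => {q | v.1 q.2 - v.1 q.1 < c q.1 q.2 + critValue c}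
  have hU : ∀ v, IsOpen (U v) := fun v =>
    isOpen_lt ((v.2.1.comp continuous_snd).sub (v.2.1.comp continuous_fst))
      (hcont.add continuous_const)
  obtain ⟨T, hT, hTU⟩ := TopologicalSpace.isOpen_iUnion_countable U hU
  obtain ⟨e, he⟩ := (hT.insert ⟨v₀, hv₀c, hv₀d⟩).exists_eq_range (insert_nonempty _ _)
  obtain ⟨w, hwc, hwd, hws, -⟩ := exists_dominated_of_sequence (c := c) (α := critValue c)
    (v := fun n x => (e n).1 x - (e n).1 x₀) (g := fun x => k * dist x₀ x + D)
    (fun n => (e n).2.1.sub continuous_const)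
    (fun n x y => by have := (e n).2.2 x y; simp only; linarith) (by fun_prop)
    (fun n x => by
      have h1 := hgrow _ le_rfl _ (e n).2.2 x₀ x
      have h2 := hgrow _ le_rfl _ (e n).2.2 x x₀
      rw [dist_comm] at h2
      have h3 : 0 ≤ n * (k * dist x₀ x + D) := by positivity
      rw [abs_le]
      constructor <;> linarith)
  refine ⟨w, hwc, hwd, fun x y hxy => lt_of_le_of_ne (hwd x y) fun heq => ?_⟩
  simp only [aubryPairsSet, mem_ofPred_eq, not_forall] at hxy
  obtain ⟨u, hu, hxyu⟩ := hxy
  obtain ⟨v, hvc, hvd, hvs, -⟩ := exists_strict_off_aubryPairs hB hK hlen hcont hsl hub hu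
  have hmem : (x, y) ∈ ⋃ i ∈ T, U i := by
    rw [hTU]
    exact mem_iUnion.2 ⟨⟨v, hvc, hvd⟩, hvs x y hxyu⟩
  simp only [mem_iUnion] at hmem
  obtain ⟨i, hi, hxi⟩ := hmem
  obtain ⟨n, rfl⟩ : i ∈ range e := he ▸ mem_insert_of_mem _ hi
  have h1 := hws x y heq n
  have h2 : (e n).1 y - (e n).1 x < c x y + critValue c := hxi
  linarith

theorem strict_subsolutions {X : Type*} [MetricSpace X] [Nonempty X] [ProperSpace X]
    {B K : ℝ} (hB : 1 ≤ B) (hK : 0 < K) (hlen : IsBLengthSpaceAtScale X B K)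
    {c : X → X → ℝ} (hcont : Continuous fun q : X × X => c q.1 q.2)
    (hsl : UniformlySuperlinear c) (hub : UniformlyBounded c) :
    (∀ u : X → ℝ, Dominated c (critValue c) u →
      ∃ u' : X → ℝ, Continuous u' ∧ Dominated c (critValue c) u' ∧
        (∀ x y : X, (x, y) ∉ aubryPairs c u → u' y - u' x < c x y + critValue c) ∧
        (∀ x ∈ projAubry c u, u' x = u x)) ∧
    (∃ u' : X → ℝ, Continuous u' ∧ Dominated c (critValue c) u' ∧
      ∀ x y : X, (x, y) ∉ aubryPairsSet c → u' y - u' x < c x y + critValue c) :=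
  ⟨fun _ hu => exists_strict_off_aubryPairs hB hK hlen hcont hsl hub hu,
    exists_strict_off_aubryPairsSet hB hK hlen hcont hsl hub⟩
end
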